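/- Let k be a field of characteristic 0 and v ∈ k a unit that is not a root of unity; set q = v². Let R₀ be the tensor R-matrix of R_q(3) and R_v(2), indexed by pairs from S = {1,2,3} × {1,2}, P the flip matrix on S, R = v⁻¹·R₀, and R′ = R(PR)² + (q⁻¹ − q − q⁻²)·R(PR) + (q⁻¹ − 1 − q⁻³)·R + (q⁻² + 1)·P. Let Ṽ(R′) be the quotient of the braided vector algebra V(R′) by the two-sided ideal generated by the quantum Serre elements (e^{(i+1,j)})² e^{(i,j)} − (1+q) e^{(i+1,j)} e^{(i,j)} e^{(i+1,j)} + q e^{(i,j)} (e^{(i+1,j)})² for i ∈ {1,2}, j ∈ {1,2}, and (e^{(3,j)})² e^{(1,j)} − (1+q) e^{(3,j)} e^{(1,j)} e^{(3,j)} + q e^{(1,j)} (e^{(3,j)})² for j ∈ {1,2}. Then in Ṽ(R′) the following relations hold: (a) e^{(j,2)} e^{(j,1)} = v · e^{(j,1)} e^{(j,2)} for j = 1, 2, 3; (b) e^{(i,1)} e^{(i+1,2)} − v⁻¹ e^{(i,2)} e^{(i+1,1)} + q e^{(i+1,1)} e^{(i,2)} − v e^{(i+1,2)} e^{(i,1)}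 = 0 for i = 1, 2. -/

import Mathlib

/-!
STATEMENT 15: relations in the quotient `Ṽ(R′)` of the braided vector algebra
`V(R′)` (for the `F₄` grafting data) by the quantum Serre relations:
(a) `e^{(j,2)} e^{(j,1)} = v e^{(j,1)} e^{(j,2)}`;
(b) `e^{(i,1)} e^{(i+1,2)} − v⁻¹ e^{(i,2)} e^{(i+1,1)} + q e^{(i+1,1)} e^{(i,2)}
     − v e^{(i+1,2)} e^{(i,1)} = 0`.
Indices are 0-based: `{1,2,3} ↦ Fin 3`, `{1,2} ↦ Fin 2`.
-/

open Matrix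

/-- The flip matrix `P` on an index set `S`: `P^{ij}_{kl} = δ_{il} δ_{jk}`. -/
def flipMatrix (k S : Type*) [Semiring k] [DecidableEq S] :
    Matrix (S × S) (S × S) k :=
  fun p q => if p.1 = q.2 ∧ p.2 = q.1 then 1 else 0

/-- The type-A R-matrix `R_q(n)`. -/
def typeAR {k : Type*} [Field k] (q : k) (n : ℕ) :
    Matrix (Fin n × Fin n) (Fin n × Fin n) k :=
  fun p r =>
    (if p.1 = p.2 then q else 1) * (if p.1 = r.1 ∧ p.2 = r.2 then 1 else 0) +
    (q - q⁻¹) * (if p.1 = r.2 ∧ p.2 = r.1 ∧ p.1 < p.2 then 1 else 0)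

/-- The tensor R-matrix of two R-matrices. -/
def tensorR {k : Type*} [CommRing k] {S₁ S₂ : Type*}
    (R₁ : Matrix (S₁ × S₁) (S₁ × S₁) k) (R₂ : Matrix (S₂ × S₂) (S₂ × S₂) k) :
    Matrix ((S₁ × S₂) × (S₁ × S₂)) ((S₁ × S₂) × (S₁ × S₂)) k :=
  fun p q => R₁ (p.1.1, p.2.1) (q.1.1, q.2.1) * R₂ (p.1.2, p.2.2) (q.1.2, q.2.2)

/-- The defining relations of the braided vector algebra `V(R′)`. -/
inductive braidedRel {k S : Type*} [CommRing k] [Fintype S]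
    (R' : Matrix (S × S) (S × S) k) :
    FreeAlgebra k S → FreeAlgebra k S → Prop
  | rel (i j : S) : braidedRel R' (FreeAlgebra.ι k i * FreeAlgebra.ι k j)
      (∑ a : S, ∑ b : S, R' (j, i) (a, b) • (FreeAlgebra.ι k a * FreeAlgebra.ι k b))

/-- The braided vector algebra `V(R′)`. -/
abbrev BraidedVectorAlgebra {k : Type*} (S : Type*) [CommRing k] [Fintype S]
    (R' : Matrix (S × S) (S × S) k) : Type _ :=
  RingQuot (braidedRel R')

/-- The generator `e^i` of `V(R′)`. -/
def gen {k S : Type*} [CommRing k] [Fintype S] (R' : Matrix (S × S) (S × S) k) (i : S) :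
    BraidedVectorAlgebra S R' :=
  RingQuot.mkAlgHom k (braidedRel R') (FreeAlgebra.ι k i)

/-- The quantum Serre relations of the `F₄` grafting: setting `A = e^{(i+1,j)}`,
`B = e^{(i,j)}` (for `i ∈ {1,2}`), resp. `A = e^{(3,j)}`, `B = e^{(1,j)}`, the
relation `A² B = (1+q) A B A − q B A²`, i.e. the ideal generated by
`A²B − (1+q) ABA + q BA²`. -/
inductive serreRel {k : Type*} [Field k] (q : k)
    (R' : Matrix ((Fin 3 × Fin 2) × (Fin 3 × Fin 2)) ((Fin 3 × Fin 2) × (Fin 3 × Fin 2)) k) :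
    BraidedVectorAlgebra (Fin 3 × Fin 2) R' → BraidedVectorAlgebra (Fin 3 × Fin 2) R' → Prop
  | adj (i : Fin 2) (j : Fin 2) : serreRel q R'
      (gen R' (i.succ, j) ^ 2 * gen R' (i.castSucc, j))
      ((1 + q) • (gen R' (i.succ, j) * gen R' (i.castSucc, j) * gen R' (i.succ, j)) -
        q • (gen R' (i.castSucc, j) * gen R' (i.succ, j) ^ 2))
  | far (j : Fin 2) : serreRel q R'
      (gen R' (2, j) ^ 2 * gen R' (0, j))
      ((1 + q) • (gen R' (2, j) * gen R' (0, j) * gen R' (2, j)) -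
        q • (gen R' (0, j) * gen R' (2, j) ^ 2))

/-- The quotient braided vector algebra `Ṽ(R′)`. -/
abbrev TildeV {k : Type*} [Field k] (q : k)
    (R' : Matrix ((Fin 3 × Fin 2) × (Fin 3 × Fin 2)) ((Fin 3 × Fin 2) × (Fin 3 × Fin 2)) k) :
    Type _ :=
  RingQuot (serreRel q R')

/-- The image of the generator `e^i` in `Ṽ(R′)`. -/
noncomputable def genT {k : Type*} [Field k] (q : k)
    (R' : Matrix ((Fin 3 × Fin 2) × (Fin 3 × Fin 2)) ((Fin 3 × Fin 2) × (Fin 3 × Fin 2)) k)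
    (i : Fin 3 × Fin 2) : TildeV q R' :=
  RingQuot.mkAlgHom k (serreRel q R') (gen R' i)

section EigenvectorRelations

variable {k : Type*}

theorem flipMatrix_mul_apply [Semiring k] {S T : Type*} [Fintype S] [DecidableEq S]
    (M : Matrix (S × S) T k) (i j : S) (r : T) :
    (flipMatrix k S * M) (i, j) r = M (j, i) r := by
  rw [Matrix.mul_apply, Finset.sum_eq_single (j, i)]
  · simp [flipMatrix]
  · rintro ⟨a, b⟩ - h
    have : ¬ (i = b ∧ j = a) := by
      rintro ⟨rfl, rfl⟩
      exact h rfl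
    simp [flipMatrix, this]
  · simp

theorem flipMatrix_mul_self [Semiring k] {S : Type*} [Fintype S] [DecidableEq S] :
    flipMatrix k S * flipMatrix k S = 1 := by
  ext ⟨i, j⟩ ⟨a, b⟩
  rw [flipMatrix_mul_apply]
  simp [flipMatrix, Matrix.one_apply, and_comm]

theorem flipMatrix_mul_tensorR [CommRing k] {S₁ S₂ : Type*} [Fintype S₁] [DecidableEq S₁]
    [Fintype S₂] [DecidableEq S₂]
    (A : Matrix (S₁ × S₁) (S₁ × S₁) k) (B : Matrix (S₂ × S₂) (S₂ × S₂) k) :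
    flipMatrix k (S₁ × S₂) * tensorR A B =
      tensorR (flipMatrix k S₁ * A) (flipMatrix k S₂ * B) := by
  ext ⟨i, j⟩ r
  simp [flipMatrix_mul_apply, tensorR]

/-- The tensor product of two vectors indexed by pairs. -/
def tensorVec [CommRing k] {S₁ S₂ : Type*} (x : S₁ × S₁ → k) (y : S₂ × S₂ → k) :
    (S₁ × S₂) × (S₁ × S₂) → k :=
  fun p => x (p.1.1, p.2.1) * y (p.1.2, p.2.2)

theorem tensorVec_vecMul_tensorR [CommRing k] {S₁ S₂ : Type*} [Fintype S₁] [Fintype S₂]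
    (x : S₁ × S₁ → k) (y : S₂ × S₂ → k)
    (A : Matrix (S₁ × S₁) (S₁ × S₁) k) (B : Matrix (S₂ × S₂) (S₂ × S₂) k) :
    tensorVec x y ᵥ* tensorR A B = tensorVec (x ᵥ* A) (y ᵥ* B) := by
  ext r
  simp only [Matrix.vecMul, dotProduct, tensorVec, Finset.sum_mul_sum]
  rw [← Fintype.sum_prod_type', Fintype.sum_equiv (Equiv.prodProdProdComm S₁ S₂ S₁ S₂)]
  rintro ⟨⟨a, b⟩, c, d⟩
  simp only [tensorR, Equiv.prodProdProdComm_apply]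
  ring

theorem tensorVec_smul_smul [CommRing k] {S₁ S₂ : Type*} (a b : k)
    (x : S₁ × S₁ → k) (y : S₂ × S₂ → k) :
    tensorVec (a • x) (b • y) = (a * b) • tensorVec x y := by
  ext p
  simp only [tensorVec, Pi.smul_apply, smul_eq_mul]
  ring

variable [Field k]

theorem row_flip_typeAR_diag (q : k) {n : ℕ} (i : Fin n) :
    (flipMatrix k (Fin n) * typeAR q n).row (i, i) = q • Pi.single (i, i) 1 := by
  ext ⟨a, b⟩
  simp [Matrix.row, flipMatrix_mul_apply, typeAR, Pi.single_apply, eq_comm]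

theorem row_flip_typeAR_of_lt (q : k) {n : ℕ} {i j : Fin n} (h : i < j) :
    (flipMatrix k (Fin n) * typeAR q n).row (i, j) = Pi.single (j, i) 1 := by
  ext ⟨a, b⟩
  simp [Matrix.row, flipMatrix_mul_apply, typeAR, Pi.single_apply, h.ne', h.not_gt, eq_comm]

theorem row_flip_typeAR_of_gt (q : k) {n : ℕ} {i j : Fin n} (h : i < j) :
    (flipMatrix k (Fin n) * typeAR q n).row (j, i) =
      Pi.single (i, j) 1 + (q - q⁻¹) • Pi.single (j, i) 1 := by
  ext ⟨a, b⟩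
  simp [Matrix.row, flipMatrix_mul_apply, typeAR, Pi.single_apply, h, h.ne, eq_comm, and_comm]

theorem vecMul_flip_typeAR_diag (q : k) {n : ℕ} (i : Fin n) :
    (Pi.single (i, i) 1 : Fin n × Fin n → k) ᵥ* (flipMatrix k (Fin n) * typeAR q n) =
      q • Pi.single (i, i) 1 := by
  rw [Matrix.single_one_vecMul, row_flip_typeAR_diag]

theorem vecMul_flip_typeAR_symm {q : k} (hq : q ≠ 0) {n : ℕ} {i j : Fin n} (h : i < j) :
    (Pi.single (i, j) 1 + q • Pi.single (j, i) 1 : Fin n × Fin n → k) ᵥ*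
        (flipMatrix k (Fin n) * typeAR q n) =
      q • (Pi.single (i, j) 1 + q • Pi.single (j, i) 1) := by
  rw [Matrix.add_vecMul, Matrix.smul_vecMul, Matrix.single_one_vecMul, Matrix.single_one_vecMul,
    row_flip_typeAR_of_lt q h, row_flip_typeAR_of_gt q h]
  ext p
  simp only [Pi.add_apply, Pi.smul_apply, smul_eq_mul]
  field_simp
  ring

theorem vecMul_flip_typeAR_skew {q : k} (hq : q ≠ 0) {n : ℕ} {i j : Fin n} (h : i < j) :
    (Pi.single (i, j) 1 - q⁻¹ • Pi.single (j, i) 1 : Fin n × Fin n → k) ᵥ*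
        (flipMatrix k (Fin n) * typeAR q n) =
      (-q⁻¹) • (Pi.single (i, j) 1 - q⁻¹ • Pi.single (j, i) 1) := by
  rw [Matrix.sub_vecMul, Matrix.smul_vecMul, Matrix.single_one_vecMul, Matrix.single_one_vecMul,
    row_flip_typeAR_of_lt q h, row_flip_typeAR_of_gt q h]
  ext p
  simp only [Pi.add_apply, Pi.sub_apply, Pi.smul_apply, smul_eq_mul]
  field_simp
  ring

theorem eq_zero_of_eq_smul {M : Type*} [AddCommGroup M] [Module k M] {c : k} (hc : c ≠ 1) {x : M}
    (h : x = c • x) : x = 0 := by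
  have h' : (1 - c) • x = 0 := by rw [sub_smul, one_smul, ← h, sub_self]
  exact (smul_eq_zero.mp h').resolve_left (sub_ne_zero.mpr hc.symm)

theorem eq_smul_of_add_neg_inv_smul_eq_zero {M : Type*} [AddCommGroup M] [Module k M] {c : k}
    (hc : c ≠ 0) {x y : M} (h : x + -c⁻¹ • y = 0) : y = c • x := by
  rw [neg_smul, ← sub_eq_add_neg, sub_eq_zero] at h
  rw [h, smul_smul, mul_inv_cancel₀ hc, one_smul]

theorem gen_mul_gen {S : Type*} [Fintype S] [DecidableEq S] (R' : Matrix (S × S) (S × S) k)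
    (i j : S) :
    gen R' i * gen R' j =
      ∑ p : S × S, (flipMatrix k S * R') (i, j) p • (gen R' p.1 * gen R' p.2) := by
  have h := RingQuot.mkAlgHom_rel k (braidedRel.rel (R' := R') i j)
  simpa only [map_mul, map_sum, map_smul, flipMatrix_mul_apply, Fintype.sum_prod_type, gen]
    using h

/-- A left eigenvector of `P R'` with eigenvalue different from `1` gives a quadratic relation
in the braided vector algebra. -/
theorem sum_smul_gen_mul_gen_eq_zero {S : Type*} [Fintype S] [DecidableEq S]
    (R' : Matrix (S × S) (S × S) k) (w : S × S → k) {c : k} (hc : c ≠ 1)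
    (hw : w ᵥ* (flipMatrix k S * R') = c • w) :
    ∑ p : S × S, w p • (gen R' p.1 * gen R' p.2) = 0 := by
  have h : ∑ p : S × S, w p • (gen R' p.1 * gen R' p.2) =
      c • ∑ p : S × S, w p • (gen R' p.1 * gen R' p.2) := by
    calc _ = ∑ r : S × S, (w ᵥ* (flipMatrix k S * R')) r • (gen R' r.1 * gen R' r.2) := by
          simp only [Matrix.vecMul, dotProduct, Finset.sum_smul]
          rw [Finset.sum_comm]
          refine Finset.sum_congr rfl fun p _ => ?_
          simp only [mul_smul, ← Finset.smul_sum]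
          rw [← gen_mul_gen]
      _ = _ := by
          simp only [hw, Pi.smul_apply, smul_eq_mul, mul_smul, Finset.smul_sum]
  exact eq_zero_of_eq_smul hc h

/-- A left eigenvector of `P R` with eigenvalue `-1` is a left eigenvector of `P R'`, for `R'` the
cubic expression in the braiding used in the `F₄` grafting. -/
theorem vecMul_flip_cubic {S : Type*} [Fintype S] [DecidableEq S] (R : Matrix (S × S) (S × S) k)
    (w : S × S → k) (hw : w ᵥ* (flipMatrix k S * R) = -w) (a b c : k) :
    w ᵥ* (flipMatrix k S * (R * (flipMatrix k S * R) ^ 2 + a • (R * (flipMatrix k S * R)) +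
      b • R + c • flipMatrix k S)) = (-1 + a - b + c) • w := by
  simp only [mul_add, Matrix.mul_smul, ← mul_assoc (flipMatrix k S) R, flipMatrix_mul_self]
  generalize flipMatrix k S * R = Ψ at hw ⊢
  simp only [pow_two, Matrix.vecMul_add, Matrix.vecMul_smul, Matrix.vecMul_one,
    ← Matrix.vecMul_vecMul, hw, Matrix.neg_vecMul]
  module

theorem sum_smul_genT_mul_genT_eq_zero {q : k}
    {R' : Matrix ((Fin 3 × Fin 2) × (Fin 3 × Fin 2)) ((Fin 3 × Fin 2) × (Fin 3 × Fin 2)) k}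
    {w : (Fin 3 × Fin 2) × (Fin 3 × Fin 2) → k}
    (h : ∑ p, w p • (gen R' p.1 * gen R' p.2) = 0) :
    ∑ p, w p • (genT q R' p.1 * genT q R' p.2) = 0 := by
  simpa only [map_sum, map_smul, map_mul, map_zero, genT] using
    congrArg (RingQuot.mkAlgHom k (serreRel q R')) h

end EigenvectorRelations

theorem tildeV_F4_relations {k : Type*} [Field k] [CharZero k] (v : k) (hv : v ≠ 0)
    (hroot : ∀ r : ℕ, 0 < r → v ^ r ≠ 1) :
    let q := v ^ 2
    let R₀ := tensorR (typeAR q 3) (typeAR v 2)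
    let P := flipMatrix k (Fin 3 × Fin 2)
    let R := v⁻¹ • R₀
    let R' := R * (P * R) ^ 2 + (q⁻¹ - q - q⁻¹ ^ 2) • (R * (P * R)) +
      (q⁻¹ - 1 - q⁻¹ ^ 3) • R + (q⁻¹ ^ 2 + 1) • P
    -- (a)
    (∀ j : Fin 3, genT q R' (j, 1) * genT q R' (j, 0)
        = v • (genT q R' (j, 0) * genT q R' (j, 1))) ∧
    -- (b)
    (∀ i : Fin 2,
      genT q R' (i.castSucc, 0) * genT q R' (i.succ, 1)
        - v⁻¹ • (genT q R' (i.castSucc, 1) * genT q R' (i.succ, 0))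
        + q • (genT q R' (i.succ, 0) * genT q R' (i.castSucc, 1))
        - v • (genT q R' (i.succ, 1) * genT q R' (i.castSucc, 0)) = 0) := by
  intro q R₀ P R R'
  have hq : q ≠ 0 := pow_ne_zero 2 hv
  have hc : -1 + (q⁻¹ - q - q⁻¹ ^ 2) - (q⁻¹ - 1 - q⁻¹ ^ 3) + (q⁻¹ ^ 2 + 1) ≠ 1 := by
    intro h
    have h0 : (1 - q) * (1 + q) * (1 + q ^ 2) = 0 := by
      field_simp at h
      linear_combination h
    have h8 : v ^ 8 = 1 := by
      linear_combination -h0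
    exact hroot 8 (by norm_num) h8
  have key (x : Fin 3 × Fin 3 → k) (hx : x ᵥ* (flipMatrix k (Fin 3) * typeAR q 3) = q • x) :
      ∑ p, tensorVec x (Pi.single (0, 1) 1 - v⁻¹ • Pi.single (1, 0) 1 : Fin 2 × Fin 2 → k) p •
        (genT q R' p.1 * genT q R' p.2) = 0 := by
    refine sum_smul_genT_mul_genT_eq_zero (sum_smul_gen_mul_gen_eq_zero R' _ hc
      (vecMul_flip_cubic R _ ?_ _ _ _))
    simp only [R, R₀]
    rw [Matrix.mul_smul, flipMatrix_mul_tensorR, Matrix.vecMul_smul, tensorVec_vecMul_tensorR, hx,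
      vecMul_flip_typeAR_skew hv Fin.zero_lt_one, tensorVec_smul_smul, smul_smul]
    have : v⁻¹ * (q * -v⁻¹) = -1 := by
      simp only [q]
      field_simp
    rw [this, neg_one_smul]
  refine ⟨fun j => ?_, fun i => ?_⟩
  · have h := key _ (vecMul_flip_typeAR_diag q j)
    refine eq_smul_of_add_neg_inv_smul_eq_zero (M := TildeV q R') hv ?_
    simpa [Fintype.sum_prod_type, tensorVec, Pi.single_apply, ite_and, sub_eq_add_neg, -neg_smul] using h
  · have h := key _ (vecMul_flip_typeAR_symm hq (Fin.castSucc_lt_succ (i := i)))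
    have hqv : q * v⁻¹ = v := by
      simp only [q]
      field_simp
    clear_value R' q
    fin_cases i <;>
    · simp [Fintype.sum_prod_type, Fin.sum_univ_three, tensorVec, Pi.single_apply] at h ⊢
      rw [hqv] at h
      rw [← h]
      module
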